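/- If G is a 2-degenerate simple graph with maximum degree Δ such that G admits no acyclic edge coloring using Δ+1 colors while for every edge e of G the graph G−e admits an acyclic edge coloring using Δ+1 colors, then Δ ≥ 4. -/

import Mathlib

open SimpleGraph

namespace AEC

variable {V : Type*}

/-- The set of colors appearing (under partial coloring `c`) on colored edges incident
with the vertex `u` (i.e. `F_u`). -/
def colorsAt (G : SimpleGraph V) (c : Sym2 V → Option ℕ) (u : V) : Set ℕ :=
  {γ | ∃ z, G.Adj u z ∧ c s(u, z) = some γ}

/-- `S_ab`: the set of colors appearing on the colored edges incident with `b`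
other than the edge `ab`. -/
def Sset (G : SimpleGraph V) (c : Sym2 V → Option ℕ) (a b : V) : Set ℕ :=
  {γ | ∃ z, G.Adj b z ∧ z ≠ a ∧ c s(b, z) = some γ}

/-- A partial edge coloring (colors are `ℕ`, `none` = uncolored): it may only color
edges of `G`, and colored edges sharing an endpoint receive distinct colors. -/
def ProperPartialColoring (G : SimpleGraph V) (c : Sym2 V → Option ℕ) : Prop :=
  (∀ e, (c e).isSome → e ∈ G.edgeSet) ∧
  ∀ ⦃u v w : V⦄, G.Adj u v → G.Adj u w → v ≠ w → (c s(u, v)).isSome →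
    c s(u, v) ≠ c s(u, w)

/-- A valid (acyclic) partial coloring: proper, and no cycle of `G` is bichromatic,
i.e. no cycle has all of its edges colored using only two colors. -/
def AcyclicPartialColoring (G : SimpleGraph V) (c : Sym2 V → Option ℕ) : Prop :=
  ProperPartialColoring G c ∧
  ∀ (α β : ℕ) (v : V) (W : G.Walk v v), W.IsCycle →
    ¬ ∀ e ∈ W.edges, c e = some α ∨ c e = some β

/-- An acyclic edge coloring of `G` using (at most) `k` colors: a valid partial coloring
that colors every edge of `G` with a color `< k`. -/
def IsAcyclicEdgeColoring (G : SimpleGraph V) (k : ℕ) (c : Sym2 V → Option ℕ) : Prop :=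
  AcyclicPartialColoring G c ∧ ∀ e ∈ G.edgeSet, ∃ a, a < k ∧ c e = some a

/-- `G` is 2-degenerate: every nonempty (induced) subgraph has a vertex of degree at most 2. -/
def TwoDegenerate [DecidableEq V] (G : SimpleGraph V) [DecidableRel G.Adj] : Prop :=
  ∀ s : Finset V, s.Nonempty → ∃ v ∈ s, (s.filter fun u => G.Adj v u).card ≤ 2

/-- A maximal `(α,β)`-bichromatic path from `a` to `b`: a path all of whose edges are
colored `α` or `β`, which cannot be extended at either end. -/
def IsMaximalBichromaticPath (G : SimpleGraph V) (c : Sym2 V → Option ℕ)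
    (α β : ℕ) {a b : V} (W : G.Walk a b) : Prop :=
  W.IsPath ∧ (∀ e ∈ W.edges, c e = some α ∨ c e = some β) ∧
  (∀ w, G.Adj a w → (c s(a, w) = some α ∨ c s(a, w) = some β) → w ∈ W.support) ∧
  (∀ w, G.Adj b w → (c s(b, w) = some α ∨ c s(b, w) = some β) → w ∈ W.support)

/-- An `(α,β,a,b)`-maximal bichromatic path: a maximal `(α,β)`-bichromatic path from
`a` to `b` whose edge incident on `a` is colored `α`. -/
def IsMaxBichromaticPathFrom (G : SimpleGraph V) (c : Sym2 V → Option ℕ)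
    (α β : ℕ) {a b : V} (W : G.Walk a b) : Prop :=
  IsMaximalBichromaticPath G c α β W ∧ ∃ e, W.edges.head? = some e ∧ c e = some α

/-- An `(α,β,ab)`-critical path: a maximal `(α,β)`-bichromatic path from `a` to `b` whose
edges incident on `a` and on `b` are both colored `α`. -/
def IsCriticalPath (G : SimpleGraph V) (c : Sym2 V → Option ℕ)
    (α β : ℕ) {a b : V} (W : G.Walk a b) : Prop :=
  IsMaxBichromaticPathFrom G c α β W ∧ ∃ e, W.edges.getLast? = some e ∧ c e = some α

/-- `F''_x(c)`: colors of edges from `x` to its neighbors (other than `y`) of degree ≥ 3. -/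
def Fpp [Fintype V] (G : SimpleGraph V) [DecidableRel G.Adj]
    (c : Sym2 V → Option ℕ) (x y : V) : Set ℕ :=
  {γ | ∃ z, G.Adj x z ∧ z ≠ y ∧ 3 ≤ G.degree z ∧ c s(x, z) = some γ}

/-- `F'_x(c)`: colors of edges from `x` to its neighbors (other than `y`) of degree 2. -/
def Fp [Fintype V] (G : SimpleGraph V) [DecidableRel G.Adj]
    (c : Sym2 V → Option ℕ) (x y : V) : Set ℕ :=
  {γ | ∃ z, G.Adj x z ∧ z ≠ y ∧ G.degree z = 2 ∧ c s(x, z) = some γ}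

/-- `F_x(c) = F'_x(c) ∪ F''_x(c)`. -/
def Fx [Fintype V] (G : SimpleGraph V) [DecidableRel G.Adj]
    (c : Sym2 V → Option ℕ) (x y : V) : Set ℕ :=
  Fp G c x y ∪ Fpp G c x y

/-- Every vertex of `S` has an `α`-colored edge and a `β`-colored edge into `S`. -/
def BichromaticClosed (f : V → V → Option ℕ) (α β : ℕ) (S : Set V) : Prop :=
  ∀ v ∈ S, (∃ w ∈ S, f v w = some α) ∧ ∃ w ∈ S, f v w = some β

/-- An acyclic edge coloring with `k` colors of the graph with adjacency relation `H`, as a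
function of the two endpoints of an edge, with bichromatic cycles replaced by nonempty
bichromatically closed sets of vertices. -/
structure GoodColoring (H : V → V → Prop) (k : ℕ) (f : V → V → Option ℕ) : Prop where
  symm : ∀ u v, f u v = f v u
  adj : ∀ u v γ, f u v = some γ → H u v
  colored : ∀ u v, H u v → ∃ γ < k, f u v = some γ
  proper : ∀ u v w γ, f u v = some γ → f u w = some γ → v = w
  acyclic : ∀ α β, α ≠ β → ∀ S : Set V, S.Nonempty → ¬ BichromaticClosed f α β S

theorem GoodColoring.lt {H : V → V → Prop} {k : ℕ} {f : V → V → Option ℕ}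
    (hf : GoodColoring H k f) {u v : V} {γ : ℕ} (h : f u v = some γ) : γ < k := by
  obtain ⟨δ, hδ, h'⟩ := hf.colored u v (hf.adj u v γ h)
  grind

theorem IsAcyclicEdgeColoring.goodColoring [Finite V] {H : SimpleGraph V} {k : ℕ}
    {c : Sym2 V → Option ℕ} (hc : IsAcyclicEdgeColoring H k c) :
    GoodColoring H.Adj k fun u v => c s(u, v) := by
  obtain ⟨⟨⟨hsupp, hproper⟩, hacyc⟩, hcol⟩ := hc
  have hadj : ∀ {u v γ}, c s(u, v) = some γ → H.Adj u v := fun {u v γ} h =>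
    hsupp s(u, v) (by simp [h])
  have hprop : ∀ u v w γ, c s(u, v) = some γ → c s(u, w) = some γ → v = w := by
    intro u v w γ hv hw
    by_contra hne
    exact hproper (hadj hv) (hadj hw) hne (by simp [hv]) (by rw [hv, hw])
  refine ⟨fun u v => by rw [Sym2.eq_swap], fun u v γ h => hadj h, fun u v h => ?_, hprop, ?_⟩
  · simpa using hcol s(u, v) h
  · rintro α β hαβ S ⟨v₀, hv₀⟩ hS
    let B : SimpleGraph V :=
      { Adj := fun u v => u ∈ S ∧ v ∈ S ∧ (c s(u, v) = some α ∨ c s(u, v) = some β)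
        symm := ⟨fun u v ⟨hu, hv, h⟩ => ⟨hv, hu, by rwa [Sym2.eq_swap]⟩⟩
        loopless := ⟨fun v ⟨_, _, h⟩ => by
          rcases h with h | h <;> exact (hadj h).ne rfl⟩ }
    have hBH : B ≤ H := fun u v ⟨_, _, h⟩ => by rcases h with h | h <;> exact hadj h
    have hB : B.IsCycles := by
      rintro v ⟨w, hv, -, -⟩
      obtain ⟨⟨a, ha, hca⟩, b, hb, hcb⟩ := hS v hv
      have hne : a ≠ b := by
        rintro rfl
        exact hαβ (Option.some.inj (hca.symm.trans hcb))
      have : B.neighborSet v = {a, b} := by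
        ext u
        constructor
        · rintro ⟨-, -, h | h⟩
          · exact Or.inl (hprop _ _ _ _ h hca)
          · exact Or.inr (hprop _ _ _ _ h hcb)
        · rintro (rfl | rfl)
          · exact ⟨hv, ha, Or.inl hca⟩
          · exact ⟨hv, hb, Or.inr hcb⟩
      rw [this, Set.ncard_pair hne]
    obtain ⟨w₀, hw₀, hc₀⟩ := (hS v₀ hv₀).1
    have hadj₀ : B.Adj v₀ w₀ := ⟨hv₀, hw₀, Or.inl hc₀⟩
    obtain ⟨p, hp, -⟩ := hB.exists_cycle_toSubgraph_verts_eq_connectedComponentSupp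
      (c := B.connectedComponentMk v₀) (v := v₀) rfl ⟨w₀, hadj₀⟩
    refine hacyc α β v₀ (p.mapLe hBH) ((Walk.isCycle_mapLe hBH).2 hp) fun e he => ?_
    rw [Walk.edges_mapLe_eq_edges] at he
    have := p.edges_subset_edgeSet he
    induction e with
    | h u v => exact this.2.2

theorem GoodColoring.exists_isAcyclicEdgeColoring {H : SimpleGraph V} {k : ℕ}
    {f : V → V → Option ℕ} (hf : GoodColoring H.Adj k f) :
    ∃ c : Sym2 V → Option ℕ, IsAcyclicEdgeColoring H k c := by
  refine ⟨Sym2.lift ⟨f, hf.symm⟩, ⟨⟨fun e => ?_, ?_⟩, ?_⟩, fun e => ?_⟩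
  · induction e with
    | h u v =>
      intro h
      exact hf.adj u v _ (Option.isSome_iff_exists.1 h).choose_spec
  · intro u v w hv hw hne hsome heq
    obtain ⟨γ, hγ⟩ := Option.isSome_iff_exists.1 hsome
    exact hne (hf.proper u v w γ hγ (heq.symm.trans hγ))
  · intro α β v W hW hcol
    have hnbr : ∀ u ∈ W.support, ∃ a ∈ W.support, ∃ b ∈ W.support, a ≠ b ∧
        (f u a = some α ∨ f u a = some β) ∧ (f u b = some α ∨ f u b = some β) := by
      intro u hu
      obtain ⟨a, b, hab, hN⟩ := Set.ncard_eq_two.1 (hW.ncard_neighborSet_toSubgraph_eq_two hu)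
      have hmem : ∀ a ∈ W.toSubgraph.neighborSet u,
          a ∈ W.support ∧ (f u a = some α ∨ f u a = some β) := fun a ha =>
        ⟨W.mem_verts_toSubgraph.1 (W.toSubgraph.edge_vert (W.toSubgraph.adj_symm ha)),
          hcol s(u, a) (W.mem_edges_toSubgraph.1 ha)⟩
      have ha := hmem a (by simp [hN])
      have hb := hmem b (by simp [hN])
      exact ⟨a, ha.1, b, hb.1, hab, ha.2, hb.2⟩
    have hαβ : α ≠ β := by
      rintro rfl
      obtain ⟨a, -, b, -, hab, ha, hb⟩ := hnbr v W.start_mem_support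
      exact hab (hf.proper v a b α (ha.elim id id) (hb.elim id id))
    refine hf.acyclic α β hαβ {u | u ∈ W.support} ⟨v, W.start_mem_support⟩ fun u hu => ?_
    obtain ⟨a, ha, b, hb, hab, hua, hub⟩ := hnbr u hu
    have := hf.proper u
    simp only [Set.mem_ofPred_eq]
    grind
  · induction e with
    | h u v => exact fun h => hf.colored u v h

theorem even_card_of_matched {f : V → V → Option ℕ}
    (symm : ∀ u v, f u v = f v u)
    (proper : ∀ u v w γ, f u v = some γ → f u w = some γ → v = w) (γ : ℕ)
    (irrefl : ∀ v, f v v ≠ some γ) (T : Finset V) (hT : ∀ v ∈ T, ∃ w ∈ T, f v w = some γ) :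
    Even T.card := by
  choose! g hg hfg using hT
  have : ∑ _v ∈ T, (1 : ZMod 2) = 0 := by
    refine Finset.sum_involution (fun v _ => g v) (fun _ _ => by decide) ?_ hg ?_
    · intro v hv _ h
      exact irrefl v (by simpa [h] using hfg v hv)
    · intro v hv
      exact proper (g v) _ _ γ (hfg _ (hg v hv)) ((symm _ _).trans (hfg v hv))
  simpa [ZMod.natCast_eq_zero_iff_even] using this

/-- The coloring obtained from `f` by giving the color `γ` to the edge `xy`. -/
def recolor [DecidableEq V] (f : V → V → Option ℕ) (x y : V) (γ : ℕ) :
    V → V → Option ℕ :=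
  fun u v => if (u = x ∧ v = y) ∨ (u = y ∧ v = x) then some γ else f u v

theorem GoodColoring.exists_bichromaticClosed [DecidableEq V] {G : SimpleGraph V}
    {k : ℕ} {x y : V} (hxy : G.Adj x y)
    (hG : ∀ f, ¬ GoodColoring G.Adj k f) {f : V → V → Option ℕ}
    (hf : GoodColoring (G.deleteEdges {s(x, y)}).Adj k f) {γ : ℕ} (hγ : γ < k)
    (hx : ∀ w, f x w ≠ some γ) (hy : ∀ w, f y w ≠ some γ) :
    ∃ β ≠ γ, ∃ S : Set V, x ∈ S ∧ y ∈ S ∧ BichromaticClosed (recolor f x y γ) γ β S := by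
  have hne := hxy.ne
  have hadj := hf.adj
  have hcol := hf.colored
  simp only [deleteEdges_adj, Set.mem_singleton_iff, Sym2.eq_iff] at hadj hcol
  by_contra! hcon
  refine hG (recolor f x y γ) ⟨?_, ?_, ?_, ?_, ?_⟩
  · intro u v
    have := hf.symm u v
    grind [recolor]
  · intro u v δ
    have := hadj u v δ
    have := hxy.symm
    grind [recolor]
  · intro u v
    have := hcol u v
    grind [recolor]
  · intro u v w δ
    have := hf.proper u v w δ
    have := hf.symm
    grind [recolor]
  · intro α β hαβ S hS hB
    have hmono : ∀ {α' β'}, (∀ δ, δ = α' ∨ δ = β' → ∀ v ∈ S, ∀ w ∈ S,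
        recolor f x y γ v w = some δ → f v w = some δ) →
        BichromaticClosed (recolor f x y γ) α' β' S → BichromaticClosed f α' β' S := by
      intro α' β' h hB v hv
      obtain ⟨⟨a, ha, hva⟩, b, hb, hvb⟩ := hB v hv
      exact ⟨⟨a, ha, h _ (Or.inl rfl) v hv a ha hva⟩, b, hb, h _ (Or.inr rfl) v hv b hb hvb⟩
    by_cases hxyS : x ∈ S ∧ y ∈ S
    · by_cases hα : α = γ
      · subst hα
        exact hcon β hαβ.symm S hxyS.1 hxyS.2 hB
      by_cases hβ : β = γ
      · subst hβ
        exact hcon α hαβ S hxyS.1 hxyS.2 fun v hv => (hB v hv).symm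
      · refine hf.acyclic α β hαβ S hS (hmono ?_ hB)
        grind [recolor]
    · refine hf.acyclic α β hαβ S hS (hmono ?_ hB)
      grind [recolor]

theorem GoodColoring.exists_bichromaticClosed_of_unique [DecidableEq V] {G : SimpleGraph V}
    {k : ℕ} {x y a b : V} (hxy : G.Adj x y) (hG : ∀ f, ¬ GoodColoring G.Adj k f)
    {f : V → V → Option ℕ} (hf : GoodColoring (G.deleteEdges {s(x, y)}).Adj k f) {p γ : ℕ}
    (hx : ∀ w δ, f x w = some δ → δ = p) (hxa : f x a = some p) (hyb : f y b = some p)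
    (hγ : γ < k) (hy : ∀ w, f y w ≠ some γ) :
    (∃ S : Set V, x ∈ S ∧ y ∈ S ∧ BichromaticClosed (recolor f x y γ) γ p S) ∧
      (∃ w, f a w = some γ) ∧ ∃ w, f b w = some γ := by
  have hpγ : p ≠ γ := fun h => hy b (h ▸ hyb)
  obtain ⟨β, hβ, S, hxS, hyS, hS⟩ := hf.exists_bichromaticClosed hxy hG hγ
    (fun w h => hpγ (hx w γ h).symm) hy
  have hadj := hf.adj
  simp only [deleteEdges_adj, Set.mem_singleton_iff, Sym2.eq_iff] at hadj
  have hne := hxy.ne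
  have hloop := G.loopless.irrefl
  have hxS' := hS x hxS
  have hyS' := hS y hyS
  have hprop := hf.proper
  obtain rfl : β = p := by grind [recolor]
  have haS : a ∈ S := by grind [recolor]
  have hbS : b ∈ S := by grind [recolor]
  obtain ⟨⟨a', -, haa'⟩, -⟩ := hS a haS
  obtain ⟨⟨b', -, hbb'⟩, -⟩ := hS b hbS
  refine ⟨⟨S, hxS, hyS, hS⟩, ⟨a', ?_⟩, b', ?_⟩ <;> grind [recolor]

open Classical in
/-- The colors smaller than `k` on the edges at `v`. -/
noncomputable def colorFinset (k : ℕ) (f : V → V → Option ℕ) (v : V) : Finset ℕ :=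
  (Finset.range k).filter fun γ => ∃ w, f v w = some γ

theorem GoodColoring.mem_colorFinset {H : V → V → Prop} {k : ℕ} {f : V → V → Option ℕ}
    (hf : GoodColoring H k f) {v : V} {γ : ℕ} :
    γ ∈ colorFinset k f v ↔ ∃ w, f v w = some γ := by
  simp only [colorFinset, Finset.mem_filter, Finset.mem_range, and_iff_right_iff_imp]
  rintro ⟨w, h⟩
  exact hf.lt h

theorem GoodColoring.card_colorFinset_le {H : V → V → Prop} {k : ℕ}
    {f : V → V → Option ℕ} (hf : GoodColoring H k f) {v : V} (N : Finset V)
    (hN : ∀ w, H v w → w ∈ N) : (colorFinset k f v).card ≤ N.card := by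
  classical
  refine (Finset.card_le_card fun γ hγ => ?_).trans
    (Finset.card_image_le (s := N) (f := fun w => (f v w).getD 0))
  obtain ⟨w, h⟩ := hf.mem_colorFinset.1 hγ
  exact Finset.mem_image.2 ⟨w, hN w (hf.adj v w γ h), by simp [h]⟩

/-- The only edge at `x` may be given any color `q` missing at its other end `a`. -/
theorem GoodColoring.recolor_pendant [DecidableEq V] {H : V → V → Prop} {k : ℕ} {x a : V}
    {f : V → V → Option ℕ} (hf : GoodColoring H k f) {p q : ℕ} (hxa : f x a = some p)
    (hx : ∀ w, H x w → w = a) (hq : q < k) (hqa : ∀ w, f a w ≠ some q) :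
    GoodColoring H k (recolor f x a q) := by
  have hsymm := hf.symm
  have hadj := hf.adj
  have hcol := hf.colored
  have hprop := hf.proper
  refine ⟨by grind [recolor], by grind [recolor], ?_, by grind [recolor], ?_⟩
  · intro u v h
    have := hcol u v h
    grind [recolor]
  · intro α β hαβ S hS hB
    have hxS : x ∉ S := by
      intro hxS
      have := hB x hxS
      grind [recolor]
    refine hf.acyclic α β hαβ S hS fun v hv => ?_
    have := hB v hv
    grind [recolor]

/-- At a vertex `y` with exactly two edges, the colors of these edges may be swapped provided
that neither color is used on another edge at the two neighbors. -/
theorem GoodColoring.swap [DecidableEq V] {H : V → V → Prop} {k : ℕ} {y b d : V}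
    {f : V → V → Option ℕ} (hf : GoodColoring H k f) {p q : ℕ} (hpq : p ≠ q)
    (hyb : f y b = some p) (hyd : f y d = some q) (hy : ∀ w γ, f y w = some γ → w = b ∨ w = d)
    (hb : ∀ w, f b w ≠ some q) (hd : ∀ w, f d w ≠ some p) :
    GoodColoring H k (recolor (recolor f y b q) y d p) := by
  have hsymm := hf.symm
  have hadj := hf.adj
  have hcol := hf.colored
  have hprop := hf.proper
  have hp := hf.lt hyb
  have hq := hf.lt hyd
  refine ⟨by grind [recolor], by grind [recolor], ?_, by grind [recolor], ?_⟩
  · intro u v h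
    have := hcol u v h
    grind [recolor]
  · intro α β hαβ S hS hB
    have hyS : y ∉ S := by
      intro hyS
      obtain ⟨⟨u, huS, hu⟩, v, hvS, hv⟩ := hB y hyS
      have huv : b ∈ S ∧ (α = p ∨ β = p) := by grind (splits := 30) [recolor]
      obtain ⟨w, -, hw⟩ : ∃ w ∈ S, recolor (recolor f y b q) y d p b w = some p := by
        have := hB b huv.1
        grind
      grind (splits := 30) [recolor]
    refine hf.acyclic α β hαβ S hS fun v hv => ?_
    have := hB v hv
    grind [recolor]

/-- Swapping the colors of the edges `yb` and `yd` separates the two bichromatic components. -/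
theorem BichromaticClosed.false_of_swap [Finite V] {f g : V → V → Option ℕ} {y b d : V}
    {p q r : ℕ} {S S' : Set V} (hfsymm : ∀ u v, f u v = f v u) (hgsymm : ∀ u v, g u v = g v u)
    (hfprop : ∀ u v w γ, f u v = some γ → f u w = some γ → v = w)
    (hgprop : ∀ u v w γ, g u v = some γ → g u w = some γ → v = w)
    (hirr : ∀ v γ, f v v ≠ some γ) (hpq : p ≠ q) (hrq : r ≠ q) (hrp : r ≠ p)
    (hyb : f y b = some p) (hyd : f y d = some q) (hd : ∀ w, f d w ≠ some p)
    (hgyb : g y b = some q) (hgyd : g y d = some p)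
    (hgf : ∀ u v, u ≠ y → v ≠ y → g u v = f u v) (hgy : ∀ w, w ≠ b → w ≠ d → g y w = f y w)
    (hyS : y ∈ S) (hyS' : y ∈ S') (hS : BichromaticClosed f r p S)
    (hS' : BichromaticClosed g r p S') : False := by
  classical
  have hyne : y ≠ b ∧ y ≠ d := by grind
  have hbS' : b ∉ S' := by
    intro h
    obtain ⟨-, w, -, hw⟩ := hS' b h
    by_cases hwy : w = y
    · subst hwy
      rw [hgsymm, hgyb] at hw
      exact hpq (Option.some.inj hw).symm
    · rw [hgf b w hyne.1.symm hwy] at hw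
      exact hwy (hfprop b w y p hw ((hfsymm b y).trans hyb))
  have hdS : d ∉ S := by
    intro h
    obtain ⟨-, w, -, hw⟩ := hS d h
    exact hd w hw
  let T : Finset V := (Set.toFinite (S ∩ S')).toFinset
  have hT : ∀ v, v ∈ T ↔ v ∈ S ∧ v ∈ S' := fun v => by simp [T]
  have hvy : ∀ v w, v ∈ S → v ∈ S' → f v w = some r → g v w = some r := by
    intro v w hv hv' hw
    by_cases hvy : v = y
    · subst hvy
      rw [hgy w] <;> grind
    by_cases hwy : w = y
    · subst hwy
      rw [hgsymm, hgy v, hfsymm, hw] <;> grind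
    · rw [hgf v w hvy hwy, hw]
  have hTr : ∀ v ∈ T, ∃ w ∈ T, f v w = some r := by
    intro v hv
    rw [hT] at hv
    obtain ⟨⟨w, hwS, hw⟩, -⟩ := hS v hv.1
    obtain ⟨⟨w', hwS', hw'⟩, -⟩ := hS' v hv.2
    obtain rfl := hgprop v w w' r (hvy v w hv.1 hv.2 hw) hw'
    exact ⟨w, (hT w).2 ⟨hwS, hwS'⟩, hw⟩
  have hTp : ∀ v ∈ T.erase y, ∃ w ∈ T.erase y, f v w = some p := by
    intro v hv
    rw [Finset.mem_erase, hT] at hv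
    obtain ⟨-, w, hwS, hw⟩ := hS v hv.2.1
    obtain ⟨-, w', hwS', hw'⟩ := hS' v hv.2.2
    have hwy : w ≠ y := by
      rintro rfl
      obtain rfl := hfprop w v b p ((hfsymm w v).trans hw) hyb
      exact hbS' hv.2.2
    obtain rfl := hgprop v w w' p ((hgf v w hv.1 hwy).trans hw) hw'
    exact ⟨w, Finset.mem_erase.2 ⟨hwy, (hT w).2 ⟨hwS, hwS'⟩⟩, hw⟩
  have h1 := even_card_of_matched hfsymm hfprop r (fun v => hirr v r) T hTr
  have h2 := even_card_of_matched hfsymm hfprop p (fun v => hirr v p) (T.erase y) hTp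
  have hyT : y ∈ T := (hT y).2 ⟨hyS, hyS'⟩
  rw [← Finset.card_erase_add_one hyT] at h1
  exact (Nat.not_even_iff_odd.2 h2.add_one) h1

theorem recolor_symm [DecidableEq V] {f : V → V → Option ℕ} (hf : ∀ u v, f u v = f v u)
    (x y : V) (γ : ℕ) (u v : V) : recolor f x y γ u v = recolor f x y γ v u := by
  grind [recolor]

theorem recolor_proper [DecidableEq V] {f : V → V → Option ℕ}
    (hf : ∀ u v w γ, f u v = some γ → f u w = some γ → v = w) {x y : V} {γ : ℕ}
    (hx : ∀ w, f x w ≠ some γ) (hy : ∀ w, f y w ≠ some γ) (u v w : V) (δ : ℕ)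
    (hv : recolor f x y γ u v = some δ) (hw : recolor f x y γ u w = some δ) : v = w := by
  have := hf u v w δ
  grind [recolor]

theorem GoodColoring.exists_of_missing_color [Finite V] [DecidableEq V] {G : SimpleGraph V}
    {k : ℕ} {x y a b d : V} (hxy : G.Adj x y) {f : V → V → Option ℕ}
    (hf : GoodColoring (G.deleteEdges {s(x, y)}).Adj k f) {p q r s : ℕ} (hpq : p ≠ q)
    (hr : r < k ∧ r ≠ p ∧ r ≠ q) (hs : s < k ∧ s ≠ p ∧ s ≠ q)
    (hxa : f x a = some p) (hxa' : ∀ w, (G.deleteEdges {s(x, y)}).Adj x w → w = a)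
    (hyb : f y b = some p) (hyd : f y d = some q) (hy : ∀ w γ, f y w = some γ → γ = p ∨ γ = q)
    (hfour : ∀ v, ∃ γ, (γ = p ∨ γ = q ∨ γ = r ∨ γ = s) ∧ ∀ w, f v w ≠ some γ) :
    ∃ g, GoodColoring G.Adj k g := by
  by_contra! hG
  have hsymm := hf.symm
  have hprop := hf.proper
  have hadj := hf.adj
  simp only [deleteEdges_adj, Set.mem_singleton_iff, Sym2.eq_iff] at hadj
  have hne := hxy.ne
  have hloop := G.loopless.irrefl
  have hxp : ∀ w δ, f x w = some δ → δ = p := fun w δ h => by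
    have := hxa' w (hf.adj _ _ _ h)
    grind
  have hblock := fun γ (hγ : γ < k ∧ γ ≠ p ∧ γ ≠ q) =>
    hf.exists_bichromaticClosed_of_unique (γ := γ) hxy hG hxp hxa hyb hγ.1
      fun w h => (hy w γ h).elim hγ.2.1 hγ.2.2
  obtain ⟨⟨S, hxS, hyS, hS⟩, har, hbr⟩ := hblock r hr
  obtain ⟨-, has, hbs⟩ := hblock s hs
  have hnot : ∀ v, (∃ w, f v w = some p) → (∃ w, f v w = some q) → (∃ w, f v w = some r) →
      (∃ w, f v w = some s) → False := by
    rintro v ⟨w₁, h₁⟩ ⟨w₂, h₂⟩ ⟨w₃, h₃⟩ ⟨w₄, h₄⟩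
    obtain ⟨γ, rfl | rfl | rfl | rfl, hv⟩ := hfour v
    exacts [hv _ h₁, hv _ h₂, hv _ h₃, hv _ h₄]
  have hqa : ∀ w, f a w ≠ some q := fun w h =>
    hnot a ⟨x, (hsymm a x).trans hxa⟩ ⟨w, h⟩ har has
  have hqb : ∀ w, f b w ≠ some q := fun w h =>
    hnot b ⟨y, (hsymm b y).trans hyb⟩ ⟨w, h⟩ hbr hbs
  have hpd : ∀ w, f d w ≠ some p := by
    -- Recoloring `xa` with `q` gives the same information about `d` as about `b`.
    have hg := hf.recolor_pendant hxa hxa' (hf.lt hyd) hqa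
    have hxg : ∀ w δ, recolor f x a q x w = some δ → δ = q := fun w δ h => by
      have := hxa' w (hg.adj _ _ _ h)
      simp_all [recolor]
    have hya : y ≠ a := by grind
    have hda : d ≠ a := by grind
    have hdx : d ≠ x := by grind
    have hyg : recolor f x a q y = f y := by
      ext1 w
      grind [recolor]
    have hdg : recolor f x a q d = f d := by
      ext1 w
      grind [recolor]
    have hd : ∀ γ, γ < k ∧ γ ≠ p ∧ γ ≠ q → ∃ w, f d w = some γ := by
      intro γ hγ
      have h := (hg.exists_bichromaticClosed_of_unique (γ := γ) (p := q) (a := a) (b := d) hxy hG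
        hxg (by simp [recolor]) (by rw [hyg, hyd]) hγ.1
        fun w h => (hy w γ (by rwa [hyg] at h)).elim hγ.2.1 hγ.2.2).2.2
      rwa [hdg] at h
    exact fun w h => hnot d ⟨w, h⟩ ⟨y, (hsymm d y).trans hyd⟩ (hd r hr) (hd s hs)
  have hybd : ∀ w γ, f y w = some γ → w = b ∨ w = d := by
    intro w γ h
    grind
  have hg := hf.swap hpq hyb hyd hybd hqb hpd
  have hbd : b ≠ d := by
    rintro rfl
    exact hpq (Option.some.inj (hyb.symm.trans hyd))
  have hyb' : y ≠ b := (hadj _ _ _ hyb).1.ne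
  have hyd' : y ≠ d := (hadj _ _ _ hyd).1.ne
  have hxy' : ∀ w, f y w ≠ none → w ≠ x := by
    rintro w hw rfl
    obtain ⟨γ, hγ⟩ := Option.ne_none_iff_exists'.1 hw
    exact (hadj _ _ _ hγ).2 (Or.inr ⟨rfl, rfl⟩)
  have hbx : b ≠ x := hxy' b (by simp [hyb])
  have hdx : d ≠ x := hxy' d (by simp [hyd])
  have hgx : recolor (recolor f y b q) y d p x = f x := by
    ext1 w
    simp [recolor, hne, hbx.symm, hdx.symm]
  have hgy : ∀ w γ, recolor (recolor f y b q) y d p y w = some γ → γ = p ∨ γ = q := by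
    intro w γ h
    have := hy w γ
    grind [recolor]
  have hgr : ∀ w, recolor (recolor f y b q) y d p y w ≠ some r := fun w h =>
    (hgy w r h).elim hr.2.1 hr.2.2
  have hgxr : ∀ w, recolor (recolor f y b q) y d p x w ≠ some r := fun w h =>
    hr.2.1 (hxp w r (by rwa [hgx] at h))
  have hyr : ∀ w, f y w ≠ some r := fun w h => (hy w r h).elim hr.2.1 hr.2.2
  obtain ⟨⟨S', -, hyS', hS'⟩, -, -⟩ :=
    hg.exists_bichromaticClosed_of_unique (γ := r) (p := p) (a := a) (b := d) hxy hG
      (by rwa [hgx]) (by rwa [hgx]) (by simp [recolor]) hr.1 hgr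
  refine BichromaticClosed.false_of_swap (b := b) (d := d) (q := q) (recolor_symm hsymm x y r)
    (recolor_symm hg.symm x y r) (recolor_proper hprop (fun w h => hr.2.1 (hxp w r h)) hyr)
    (recolor_proper hg.proper hgxr hgr) ?_ hpq hr.2.2 hr.2.1 ?_ ?_ ?_ ?_ ?_ ?_ ?_ hyS hyS' hS hS'
  · intro v γ h
    have := hadj v v γ
    have := hloop v
    grind [recolor]
  · simp [recolor, hne.symm, hbx, hyb]
  · simp [recolor, hne.symm, hdx, hyd]
  · simp [recolor, hdx, hyd'.symm, hpd]
  · simp [recolor, hne.symm, hbx, hbd, hyd']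
  · simp [recolor, hne.symm, hdx]
  · intro u v hu hv
    simp [recolor, hu, hv]
  · intro w hwb hwd
    simp [recolor, hwb, hwd, hyb', hyd']

theorem GoodColoring.exists_of_deleteEdges [Fintype V] [DecidableEq V] {G : SimpleGraph V}
    [DecidableRel G.Adj] {k : ℕ} {x y : V} (hxy : G.Adj x y) (hk : k ≤ 4)
    (hdeg : ∀ v, G.degree v + 1 ≤ k) (hx : G.degree x ≤ 2) {f : V → V → Option ℕ}
    (hf : GoodColoring (G.deleteEdges {s(x, y)}).Adj k f) : ∃ g, GoodColoring G.Adj k g := by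
  by_contra! hG
  have hadj := hf.adj
  simp only [deleteEdges_adj, Set.mem_singleton_iff, Sym2.eq_iff] at hadj
  have hle : ∀ v, (colorFinset k f v).card + 1 ≤ k := fun v =>
    (Nat.succ_le_succ (hf.card_colorFinset_le (G.neighborFinset v) fun w h => by
      simpa using h.1)).trans (hdeg v)
  have hyle : (colorFinset k f y).card + 2 ≤ k := by
    have h1 := hf.card_colorFinset_le (v := y) ((G.neighborFinset y).erase x) fun w h => by
      simp only [deleteEdges_adj, Set.mem_singleton_iff, Sym2.eq_iff] at h
      simp only [Finset.mem_erase, mem_neighborFinset]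
      grind
    rw [Finset.card_erase_of_mem (by simpa using hxy.symm), card_neighborFinset_eq_degree] at h1
    have h2 := hdeg y
    have h3 : 0 < G.degree y := (G.degree_pos_iff_exists_adj y).2 ⟨x, hxy.symm⟩
    omega
  have hxN : ((G.neighborFinset x).erase y).card ≤ 1 := by
    rw [Finset.card_erase_of_mem (by simpa using hxy), card_neighborFinset_eq_degree]
    omega
  have hxuniq : ∀ v w, (G.deleteEdges {s(x, y)}).Adj x v → (G.deleteEdges {s(x, y)}).Adj x w →
      v = w := by
    intro v w hv hw
    simp only [deleteEdges_adj, Set.mem_singleton_iff, Sym2.eq_iff] at hv hw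
    refine Finset.card_le_one.1 hxN v ?_ w ?_ <;>
    · simp only [Finset.mem_erase, mem_neighborFinset]
      grind
  have hxle : (colorFinset k f x).card ≤ 1 :=
    (hf.card_colorFinset_le ((G.neighborFinset x).erase y) fun w h => by
      simp only [deleteEdges_adj, Set.mem_singleton_iff, Sym2.eq_iff] at h
      simp only [Finset.mem_erase, mem_neighborFinset]
      grind).trans hxN
  -- The edge at `x` and some edge at `y` share a color `p`.
  obtain ⟨p, a, b, hxa, hyb⟩ : ∃ p a b, f x a = some p ∧ f y b = some p := by
    have hcard : (colorFinset k f x ∪ colorFinset k f y).card < (Finset.range k).card := by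
      have := Finset.card_union_le (colorFinset k f x) (colorFinset k f y)
      rw [Finset.card_range]
      omega
    obtain ⟨γ, hγk, hγ⟩ := Finset.exists_mem_notMem_of_card_lt_card hcard
    simp only [Finset.mem_union, hf.mem_colorFinset, not_or, not_exists] at hγ
    obtain ⟨β, hβ, S, hxS, hyS, hS⟩ := hf.exists_bichromaticClosed hxy hG
      (Finset.mem_range.1 hγk) hγ.1 hγ.2
    obtain ⟨-, a, -, ha⟩ := hS x hxS
    obtain ⟨-, b, -, hb⟩ := hS y hyS
    exact ⟨β, a, b, by grind [recolor], by grind [recolor]⟩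
  have hxa' : ∀ w, (G.deleteEdges {s(x, y)}).Adj x w → w = a := fun w h =>
    hxuniq w a h (hf.adj _ _ _ hxa)
  have hxp : ∀ w δ, f x w = some δ → δ = p := fun w δ h => by
    have := hxa' w (hf.adj _ _ _ h)
    grind
  have hblock := fun γ (hγ : γ < k) hy =>
    hf.exists_bichromaticClosed_of_unique (γ := γ) hxy hG hxp hxa hyb hγ hy
  have hpy : p ∈ colorFinset k f y := hf.mem_colorFinset.2 ⟨b, hyb⟩
  have hyk : colorFinset k f y ⊆ Finset.range k := fun γ hγ =>
    have ⟨_, h⟩ := hf.mem_colorFinset.1 hγ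
    Finset.mem_range.2 (hf.lt h)
  -- Every color missing at `y` occurs at `a`, so there are exactly two of them.
  have hsub : insert p (Finset.range k \ colorFinset k f y) ⊆ colorFinset k f a := by
    intro γ hγ
    rw [hf.mem_colorFinset]
    rcases Finset.mem_insert.1 hγ with rfl | hγ
    · exact ⟨x, (hf.symm a x).trans hxa⟩
    · rw [Finset.mem_sdiff, Finset.mem_range, hf.mem_colorFinset, not_exists] at hγ
      exact (hblock γ hγ.1 hγ.2).2.1
  have hcard : (insert p (Finset.range k \ colorFinset k f y)).card
      = k - (colorFinset k f y).card + 1 := by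
    rw [Finset.card_insert_of_notMem (by simp [hpy]), Finset.card_sdiff_of_subset hyk,
      Finset.card_range]
  have hsubcard := Finset.card_le_card hsub
  have hale := hle a
  obtain rfl : k = 4 := by omega
  have hy2 : (colorFinset 4 f y).card = 2 := by omega
  obtain ⟨r, s, hrs, hrs'⟩ : ∃ r s, r ≠ s ∧ Finset.range 4 \ colorFinset 4 f y = {r, s} :=
    Finset.card_eq_two.1 (by rw [Finset.card_sdiff_of_subset hyk, Finset.card_range, hy2])
  obtain ⟨q, hqp, hpq'⟩ : ∃ q, q ≠ p ∧ colorFinset 4 f y = {p, q} := by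
    obtain ⟨u, v, huv, h⟩ := Finset.card_eq_two.1 hy2
    rw [h] at hpy ⊢
    rcases Finset.mem_insert.1 hpy with rfl | h'
    · exact ⟨v, huv.symm, rfl⟩
    · obtain rfl := Finset.mem_singleton.1 h'
      exact ⟨u, huv, Finset.pair_comm _ _⟩
  have hmem_y : ∀ γ, (∃ w, f y w = some γ) ↔ γ = p ∨ γ = q := fun γ => by
    rw [← hf.mem_colorFinset, hpq']
    simp
  have hmem_c : ∀ γ, γ < 4 ∧ γ ≠ p ∧ γ ≠ q ↔ γ = r ∨ γ = s := fun γ => by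
    have := congrArg (γ ∈ ·) hrs'
    simpa [hpq'] using this
  obtain ⟨d, hyd⟩ := (hmem_y q).2 (Or.inr rfl)
  -- No vertex sees all four colors.
  have hfour : ∀ v, ∃ γ, (γ = p ∨ γ = q ∨ γ = r ∨ γ = s) ∧ ∀ w, f v w ≠ some γ := by
    intro v
    obtain ⟨γ, hγ, hγv⟩ := Finset.exists_mem_notMem_of_card_lt_card
      (s := colorFinset 4 f v) (t := Finset.range 4) (by
        have := hle v
        rw [Finset.card_range]
        omega)
    rw [hf.mem_colorFinset, not_exists] at hγv
    rw [Finset.mem_range] at hγ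
    refine ⟨γ, ?_, hγv⟩
    have := hmem_c γ
    tauto
  have hy' : ∀ w γ, f y w = some γ → γ = p ∨ γ = q := fun w γ h => (hmem_y γ).1 ⟨w, h⟩
  obtain ⟨g, hg⟩ := hf.exists_of_missing_color hxy hqp.symm ((hmem_c r).2 (Or.inl rfl))
    ((hmem_c s).2 (Or.inr rfl)) hxa hxa' hyb hyd hy' hfour
  exact hG g hg

/-- if `G` is a 2-degenerate simple graph with maximum degree `Δ` that
admits no acyclic edge coloring with `Δ+1` colors, while `G − e` admits one for every
edge `e`, then `Δ ≥ 4`. -/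
theorem maxDegree_ge_four_of_min_counterexample
    {V : Type*} [Fintype V] [DecidableEq V] (G : SimpleGraph V) [DecidableRel G.Adj]
    (h2deg : TwoDegenerate G)
    (hmin : ¬ ∃ c : Sym2 V → Option ℕ, IsAcyclicEdgeColoring G (G.maxDegree + 1) c)
    (hdel : ∀ e ∈ G.edgeSet, ∃ c : Sym2 V → Option ℕ,
      IsAcyclicEdgeColoring (G.deleteEdges {e}) (G.maxDegree + 1) c) :
    4 ≤ G.maxDegree := by
  by_contra! hΔ
  have hedge : ∃ u v, G.Adj u v := by
    by_contra! hG
    refine hmin (GoodColoring.exists_isAcyclicEdgeColoring (f := fun _ _ => none)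
      ⟨fun _ _ => rfl, by simp, fun u v h => (hG u v h).elim, by simp, ?_⟩)
    rintro α β - S ⟨v, hv⟩ hS
    simpa using (hS v hv).1
  obtain ⟨u, v, huv⟩ := hedge
  obtain ⟨x, hx, hxdeg⟩ := h2deg (Finset.univ.filter fun w => ∃ z, G.Adj w z)
    ⟨u, by simpa using ⟨v, huv⟩⟩
  obtain ⟨y, hxy⟩ := (Finset.mem_filter.1 hx).2
  have hdeg : G.degree x ≤ 2 := by
    refine (Finset.card_le_card fun w hw => ?_).trans hxdeg
    rw [mem_neighborFinset] at hw
    simpa [hw] using ⟨x, hw.symm⟩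
  obtain ⟨c, hc⟩ := hdel s(x, y) hxy
  obtain ⟨g, hg⟩ := hc.goodColoring.exists_of_deleteEdges hxy (by omega)
    (fun v => Nat.succ_le_succ (G.degree_le_maxDegree v)) hdeg
  exact hmin hg.exists_isAcyclicEdgeColoring

end AEC
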